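/- arXiv:1705.07584 — 7 statements merged into one kernel-verified Lean document; each statement's English description precedes it below -/
import Mathlib

section
/- (Decomposition formula, Theorem A.) Let p be a prime, a ≥ 1 an integer, and J₁ ⊊ J₂ ⊆ I subsets. Let B(J₁,J₂;a) be the set of tuples b = (b₁,…,bₜ) with bᵢ ∈ {0,…,a} for i ∈ J₂∖J₁ and bᵢ = 0 for i ∉ J₂∖J₁. For b ∈ B(J₁,J₂;a) with b ≠ (a,…,a), set J_b = {i ∈ I : bᵢ < a}, Q_b = Σ_{j∈J_b} λ_j p^{k_j b_j} x_j^{k_j}, and s(b) = Σ_{j∈J_b} b_j; for b = (a,…,a) set J_b = ∅, Q_b = 0, s(b) = 0. Then N_{J₁}(Q; c, p^a) = Σ_{b ∈ B(J₁,J₂;a)} p^{−s(b)} · N_{J₂∩J_b}(Q_b; c, p^a) (an identity of rational numbers). -/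
/-- `NJ lam k J c n` : number of tuples `x ∈ (ℤ/nℤ)^t` with
`∑ i, lam i * x i ^ k i ≡ c (mod n)` and `x j` a unit for every `j ∈ J`. -/
noncomputable def NJ {t : ℕ} (lam : Fin t → ℤ) (k : Fin t → ℕ) (J : Finset (Fin t)) (c : ℤ)
    (n : ℕ) : ℕ :=
  Nat.card {x : Fin t → ZMod n //
    (∑ i, (lam i : ZMod n) * x i ^ k i) = (c : ZMod n) ∧ ∀ j ∈ J, IsUnit (x j)}

/-- Same count, but for the sub-polynomial `Q_S = ∑_{j ∈ S} lam j * x j ^ k j`,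
counting solutions in `(ℤ/nℤ)^S` with `x j` a unit for `j ∈ J`.  (When `S = ∅`, the count
is `1` if `n ∣ c` and `0` otherwise, matching the paper's convention.) -/
noncomputable def NJOn {t : ℕ} (lam : Fin t → ℤ) (k : Fin t → ℕ) (S J : Finset (Fin t)) (c : ℤ)
    (n : ℕ) : ℕ :=
  Nat.card {x : {i : Fin t // i ∈ S} → ZMod n //
    (∑ i, (lam i.1 : ZMod n) * x i ^ k i.1) = (c : ZMod n) ∧ ∀ j, j.1 ∈ J → IsUnit (x j)}

section PrimePower

variable {p a : ℕ}

theorem ZMod.prime_pow_mul_ne_prime_pow_succ_mul (hp : p.Prime) {v : ℕ} (hv : v < a)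
    {u : ZMod (p ^ a)} (hu : IsUnit u) (y : ZMod (p ^ a)) :
    (p : ZMod (p ^ a)) ^ v * u ≠ (p : ZMod (p ^ a)) ^ (v + 1) * y := by
  intro h
  have hz : (p : ZMod (p ^ a)) ^ a = 0 := by
    exact_mod_cast ZMod.natCast_self (p ^ a)
  have h1 : (p : ZMod (p ^ a)) ^ (a - 1) * u = 0 := by
    calc (p : ZMod (p ^ a)) ^ (a - 1) * u
        = (p : ZMod (p ^ a)) ^ (a - 1 - v) * ((p : ZMod (p ^ a)) ^ v * u) := by
          rw [← mul_assoc, ← pow_add]; congr 2; omega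
      _ = (p : ZMod (p ^ a)) ^ a * y := by
          rw [h, ← mul_assoc, ← pow_add]; congr 2; omega
      _ = 0 := by rw [hz, zero_mul]
  rw [hu.mul_left_eq_zero] at h1
  have h2 : ((p ^ (a - 1) : ℕ) : ZMod (p ^ a)) = 0 := by exact_mod_cast h1
  rw [ZMod.natCast_eq_zero_iff, Nat.pow_dvd_pow_iff_le_right hp.one_lt] at h2
  omega

theorem ZMod.exists_eq_prime_pow_mul_isUnit (hp : p.Prime) (ha : 0 < a) {x : ZMod (p ^ a)}
    (hx : x ≠ 0) : ∃ v < a, ∃ u : ZMod (p ^ a), IsUnit u ∧ x = (p : ZMod (p ^ a)) ^ v * u := by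
  have : NeZero (p ^ a) := ⟨pow_ne_zero _ hp.ne_zero⟩
  have hval : x.val ≠ 0 := by rwa [Ne, ZMod.val_eq_zero]
  obtain ⟨v, m, hm, hxm⟩ := Nat.exists_eq_pow_mul_and_not_dvd hval p hp.ne_one
  refine ⟨v, ?_, (m : ZMod (p ^ a)), (ZMod.isUnit_natCast_iff_not_dvd_pow hp ha).2 hm, ?_⟩
  · by_contra! hv
    have h1 : p ^ a ∣ x.val := hxm ▸ (pow_dvd_pow p hv).mul_right m
    exact hval (Nat.eq_zero_of_dvd_of_lt h1 (ZMod.val_lt x))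
  · rw [← ZMod.natCast_zmod_val x, hxm]
    push_cast
    rfl

theorem ZMod.isUnit_of_prime_pow_mul_eq (hp : p.Prime) {v : ℕ} (hv : v < a)
    {u y : ZMod (p ^ a)} (hu : IsUnit u)
    (h : (p : ZMod (p ^ a)) ^ v * u = (p : ZMod (p ^ a)) ^ v * y) : IsUnit y := by
  have : NeZero (p ^ a) := ⟨pow_ne_zero _ hp.ne_zero⟩
  by_contra hy
  rw [← ZMod.natCast_zmod_val y, ZMod.isUnit_natCast_iff_not_dvd_pow hp (by omega), not_not] at hy
  obtain ⟨m, hm⟩ := hy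
  refine ZMod.prime_pow_mul_ne_prime_pow_succ_mul hp hv hu (m : ZMod (p ^ a)) ?_
  rw [h, ← ZMod.natCast_zmod_val y, hm]
  push_cast
  ring

theorem ZMod.card_prime_pow_mul_eq [NeZero (p ^ a)] {v : ℕ} (hv : v ≤ a)
    (u : ZMod (p ^ a)) :
    (Finset.univ.filter fun y : ZMod (p ^ a) =>
      (p : ZMod (p ^ a)) ^ v * u = (p : ZMod (p ^ a)) ^ v * y).card = p ^ v := by
  have key := AddMonoidHom.card_fiber_eq_of_mem_range
    (nsmulAddMonoidHom (p ^ v) : ZMod (p ^ a) →+ ZMod (p ^ a))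
    (x := (p ^ v) • u) (y := 0) ⟨u, rfl⟩ ⟨0, by simp⟩
  have hker := IsAddCyclic.card_nsmulAddMonoidHom_ker (ZMod (p ^ a)) (p ^ v)
  rw [Nat.card_zmod, Nat.gcd_eq_right (pow_dvd_pow p hv)] at hker
  rw [← hker]
  have h2 : Nat.card (nsmulAddMonoidHom (p ^ v) : ZMod (p ^ a) →+ ZMod (p ^ a)).ker =
      (Finset.univ.filter fun y : ZMod (p ^ a) => nsmulAddMonoidHom (p ^ v) y = 0).card := by
    rw [← Fintype.card_subtype, ← Nat.card_eq_fintype_card]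
    rfl
  rw [h2, ← key]
  congr 1
  ext y
  simp [eq_comm]

open Classical in
/-- The weight of the pair `(b, y)` as a representation of the residue `p ^ b * y` modulo `p ^ a`:
`p ^ (-b)` if `b < a` (with `y` required to be a unit when `P` holds), and for `b ≥ a` only
`y = 0` counts. -/
noncomputable def residueWeight (p a : ℕ) (P : Prop) (b : ℕ) (y : ZMod (p ^ a)) : ℚ :=
  if (b < a → P → IsUnit y) ∧ (a ≤ b → y = 0) then (if b < a then (p : ℚ) ^ (-(b : ℤ)) else 1)
  else 0

open Classical in
theorem sum_residueWeight_eq_one (hp : p.Prime) (ha : 0 < a) [NeZero (p ^ a)] {P : Prop}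
    (hP : P) (x : ZMod (p ^ a)) :
    ∑ b ∈ Finset.range (a + 1), ∑ y : ZMod (p ^ a),
      residueWeight p a P b y * (if x = (p : ZMod (p ^ a)) ^ b * y then 1 else 0) = 1 := by
  have hp0 : (p : ℚ) ≠ 0 := by exact_mod_cast hp.ne_zero
  rw [Finset.sum_range_succ]
  have hlast : ∑ y : ZMod (p ^ a),
      residueWeight p a P a y * (if x = (p : ZMod (p ^ a)) ^ a * y then 1 else 0) =
      if x = 0 then 1 else 0 := by
    rw [Finset.sum_eq_single 0]
    · simp [residueWeight]
    · intro y _ hy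
      simp [residueWeight, hy]
    · simp
  rw [hlast]
  by_cases hx : x = 0
  · rw [if_pos hx, Finset.sum_eq_zero, zero_add]
    intro b hb
    refine Finset.sum_eq_zero fun y _ => ?_
    rw [Finset.mem_range] at hb
    by_cases hy : IsUnit y
    · have h := ZMod.prime_pow_mul_ne_prime_pow_succ_mul hp hb hy 0
      rw [mul_zero] at h
      rw [hx, if_neg h.symm, mul_zero]
    · simp [residueWeight, hb, hP, hy]
  · obtain ⟨v, hv, u, hu, rfl⟩ := ZMod.exists_eq_prime_pow_mul_isUnit hp ha hx
    rw [if_neg hx, add_zero, Finset.sum_eq_single v]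
    · have h1 : ∀ y : ZMod (p ^ a), residueWeight p a P v y *
          (if (p : ZMod (p ^ a)) ^ v * u = (p : ZMod (p ^ a)) ^ v * y then 1 else 0) =
          if (p : ZMod (p ^ a)) ^ v * u = (p : ZMod (p ^ a)) ^ v * y
            then (p : ℚ) ^ (-(v : ℤ)) else 0 := by
        intro y
        split_ifs with h
        · simp [residueWeight, hv, ZMod.isUnit_of_prime_pow_mul_eq hp hv hu h]
        · simp
      rw [Finset.sum_congr rfl fun y _ => h1 y, ← Finset.sum_filter, Finset.sum_const,
        ZMod.card_prime_pow_mul_eq hv.le, nsmul_eq_mul, zpow_neg, zpow_natCast]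
      push_cast
      exact mul_inv_cancel₀ (pow_ne_zero _ hp0)
    · intro b hb hbv
      refine Finset.sum_eq_zero fun y _ => ?_
      rw [Finset.mem_range] at hb
      by_cases hy : IsUnit y
      · rw [if_neg, mul_zero]
        intro h
        rcases lt_or_gt_of_ne hbv with hlt | hlt
        · refine ZMod.prime_pow_mul_ne_prime_pow_succ_mul hp hb hy
            ((p : ZMod (p ^ a)) ^ (v - (b + 1)) * u) ?_
          rw [← h, ← mul_assoc, ← pow_add]
          congr 2
          omega
        · refine ZMod.prime_pow_mul_ne_prime_pow_succ_mul hp hv hu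
            ((p : ZMod (p ^ a)) ^ (b - (v + 1)) * y) ?_
          rw [h, ← mul_assoc, ← pow_add]
          congr 2
          omega
      · simp [residueWeight, hb, hP, hy]
    · simp [hv]

open Classical in
theorem sum_residueWeight_zero (ha : 0 < a) [NeZero (p ^ a)] (P : Prop) (x : ZMod (p ^ a)) :
    ∑ b ∈ ({0} : Finset ℕ), ∑ y : ZMod (p ^ a),
      residueWeight p a P b y * (if x = (p : ZMod (p ^ a)) ^ b * y then 1 else 0) =
      if P → IsUnit x then 1 else 0 := by
  rw [Finset.sum_singleton, Finset.sum_eq_single x]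
  · simp [residueWeight, ha, ha.ne']
  · intro y _ hy
    simp [hy.symm]
  · simp

open Classical in
theorem prod_residueWeight {ι : Type*} [Fintype ι] (P : ι → Prop) (b : ι → ℕ)
    (y : ι → ZMod (p ^ a)) :
    ∏ i, residueWeight p a (P i) (b i) (y i) =
      if ∀ i, (b i < a → P i → IsUnit (y i)) ∧ (a ≤ b i → y i = 0) then
        ∏ i, (if b i < a then (p : ℚ) ^ (-(b i : ℤ)) else 1) else 0 := by
  simp only [residueWeight]
  rw [Finset.prod_ite_zero]
  simp only [Finset.mem_univ, true_implies]

end PrimePower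

open Classical in
theorem NJ_eq_sum {t : ℕ} (lam : Fin t → ℤ) (k : Fin t → ℕ) (J : Finset (Fin t)) (c : ℤ)
    (n : ℕ) [NeZero n] :
    (NJ lam k J c n : ℚ) = ∑ x : Fin t → ZMod n,
      (if (∑ i, (lam i : ZMod n) * x i ^ k i) = (c : ZMod n) then 1 else 0) *
        ∏ i, if i ∈ J → IsUnit (x i) then 1 else 0 := by
  rw [NJ, Nat.card_eq_fintype_card, Fintype.card_subtype, Finset.card_filter]
  push_cast
  refine Finset.sum_congr rfl fun x _ => ?_
  rw [Finset.prod_ite_zero, Finset.prod_const_one]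
  split_ifs <;> simp_all

open Classical in
theorem NJOn_eq_sum {t : ℕ} (lam : Fin t → ℤ) (k : Fin t → ℕ) (hk : ∀ i, 1 ≤ k i)
    (S J : Finset (Fin t)) (c : ℤ) (n : ℕ) [NeZero n] :
    (NJOn lam k S J c n : ℚ) = ∑ x : Fin t → ZMod n,
      if (∑ i, (lam i : ZMod n) * x i ^ k i) = (c : ZMod n) ∧
        ∀ i, (i ∈ S → i ∈ J → IsUnit (x i)) ∧ (i ∉ S → x i = 0) then 1 else 0 := by
  rw [Finset.sum_boole, ← Fintype.card_subtype, ← Nat.card_eq_fintype_card, NJOn]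
  congr 1
  have hsum : ∀ x : Fin t → ZMod n, (∀ i, i ∉ S → x i = 0) →
      ∑ i : {i // i ∈ S}, (lam i.1 : ZMod n) * x i.1 ^ k i.1 =
        ∑ i, (lam i : ZMod n) * x i ^ k i := by
    intro x hx
    rw [Finset.sum_coe_sort S fun i => (lam i : ZMod n) * x i ^ k i]
    refine Finset.sum_subset (Finset.subset_univ S) fun i _ hi => ?_
    rw [hx i hi, zero_pow (by have := hk i; omega), mul_zero]
  have hext : ∀ (x : {i // i ∈ S} → ZMod n) (i : {i // i ∈ S}),
      (if h : i.1 ∈ S then x ⟨i.1, h⟩ else 0) = x i := fun x i => dif_pos i.2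
  refine Nat.card_congr
    { toFun := fun x => ⟨fun i => if h : i ∈ S then x.1 ⟨i, h⟩ else 0, ?_, ?_⟩
      invFun := fun x => ⟨fun i => x.1 i.1, ?_, ?_⟩
      left_inv := ?_
      right_inv := ?_ }
  · rw [← hsum _ fun i hi => dif_neg hi]
    simp only [hext]
    exact x.2.1
  · intro i
    refine ⟨fun hS hJ => ?_, fun hS => dif_neg hS⟩
    simp only [dif_pos hS]
    exact x.2.2 ⟨i, hS⟩ hJ
  · rw [hsum x.1 fun i => (x.2.2 i).2]
    exact x.2.1
  · exact fun j hj => (x.2.2 j.1).1 j.2 hj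
  · intro x
    ext i
    simp
  · intro x
    ext i
    by_cases h : i ∈ S
    · simp [h]
    · simp [h, (x.2.2 i).2 h]

theorem sum_prod_sum_fiber {ι R X : Type*} [Fintype ι] [DecidableEq ι] [CommSemiring R]
    [Fintype X] [DecidableEq X]
    (B : ι → Finset ℕ) (w : ι → ℕ → X → R) (φ : ℕ → X → X) (F : (ι → X) → R) :
    ∑ x : ι → X, F x * ∏ i, ∑ b ∈ B i, ∑ y : X,
        w i b y * (if x i = φ b y then 1 else 0) =
      ∑ b ∈ Fintype.piFinset B, ∑ y : ι → X, (∏ i, w i (b i) (y i)) * F fun i => φ (b i) (y i) := by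
  have h1 : ∀ x : ι → X, F x * ∏ i, ∑ b ∈ B i, ∑ y : X,
      w i b y * (if x i = φ b y then 1 else 0) =
      ∑ b ∈ Fintype.piFinset B, ∑ y : ι → X,
        if x = (fun i => φ (b i) (y i)) then (∏ i, w i (b i) (y i)) * F x else 0 := by
    intro x
    rw [Finset.prod_univ_sum, Finset.mul_sum]
    refine Finset.sum_congr rfl fun b _ => ?_
    rw [Finset.prod_univ_sum, Fintype.piFinset_univ, Finset.mul_sum]
    refine Finset.sum_congr rfl fun y _ => ?_
    rw [Finset.prod_mul_distrib, Finset.prod_ite_zero, Finset.prod_const_one]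
    simp only [funext_iff, Finset.mem_univ, true_implies]
    split_ifs
    · ring
    · simp
  rw [Finset.sum_congr rfl fun x _ => h1 x, Finset.sum_comm]
  refine Finset.sum_congr rfl fun b _ => ?_
  rw [Finset.sum_comm]
  refine Finset.sum_congr rfl fun y _ => ?_
  simp

/-- Theorem A (decomposition formula).  For `J₁ ⊊ J₂ ⊆ I`, summing over
`b ∈ B(J₁,J₂;a)` (i.e. `b i ∈ {0,…,a}` for `i ∈ J₂ ∖ J₁` and `b i = 0` otherwise), with
`J_b = {i : b i < a}`, `Q_b = ∑_{j ∈ J_b} λ_j p^{k_j b_j} x_j^{k_j}`, `s(b) = ∑_{j ∈ J_b} b j`,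
one has `N_{J₁}(Q; c, p^a) = ∑_b p^{-s(b)} N_{J₂ ∩ J_b}(Q_b; c, p^a)` as rational numbers. -/
theorem decomposition_formula (t : ℕ) (ht : 1 ≤ t) (lam : Fin t → ℤ) (hlam : ∀ i, lam i ≠ 0)
    (k : Fin t → ℕ) (hk : ∀ i, 1 ≤ k i) (p : ℕ) (hp : p.Prime) (a : ℕ) (ha : 1 ≤ a)
    (J1 J2 : Finset (Fin t)) (h12 : J1 ⊂ J2) (c : ℤ) :
    (NJ lam k J1 c (p ^ a) : ℚ) =
      ∑ b ∈ Fintype.piFinset (fun i => if i ∈ J2 \ J1 then Finset.range (a + 1) else {0}),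
        (p : ℚ) ^ (-(∑ j ∈ Finset.univ.filter (fun i => b i < a), (b j : ℤ))) *
          (NJOn (fun i => lam i * (p : ℤ) ^ (k i * b i)) k
            (Finset.univ.filter (fun i => b i < a))
            (J2 ∩ Finset.univ.filter (fun i => b i < a)) c (p ^ a) : ℚ) := by
  classical
  have : NeZero (p ^ a) := ⟨pow_ne_zero _ hp.ne_zero⟩
  have hcoord : ∀ (i : Fin t) (x : ZMod (p ^ a)),
      (if i ∈ J1 → IsUnit x then (1 : ℚ) else 0) =
        ∑ b ∈ (if i ∈ J2 \ J1 then Finset.range (a + 1) else {0}), ∑ y : ZMod (p ^ a),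
          residueWeight p a (i ∈ J2) b y *
            (if x = (p : ZMod (p ^ a)) ^ b * y then 1 else 0) := by
    intro i x
    split_ifs with h1 h2 h2
    · exact (sum_residueWeight_eq_one hp ha (Finset.mem_sdiff.1 h2).1 x).symm
    · rw [sum_residueWeight_zero ha, if_pos]
      intro h
      exact h1 (by simpa [h] using h2)
    · exact absurd (fun h => absurd h (Finset.mem_sdiff.1 h2).2) h1
    · rw [sum_residueWeight_zero ha, if_neg]
      intro h
      exact h1 fun h3 => h (h12.subset h3)
  rw [NJ_eq_sum]
  simp only [hcoord]
  rw [sum_prod_sum_fiber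
    (fun i => if i ∈ J2 \ J1 then Finset.range (a + 1) else {0})
    (fun i => residueWeight p a (i ∈ J2)) (fun b y => (p : ZMod (p ^ a)) ^ b * y)
    (fun x => if (∑ i, (lam i : ZMod (p ^ a)) * x i ^ k i) = (c : ZMod (p ^ a)) then 1 else 0)]
  refine Finset.sum_congr rfl fun b _ => ?_
  rw [NJOn_eq_sum _ _ hk, Finset.mul_sum]
  refine Finset.sum_congr rfl fun y _ => ?_
  have hQ : ∑ i, (lam i : ZMod (p ^ a)) * ((p : ZMod (p ^ a)) ^ b i * y i) ^ k i =
      ∑ i, ((lam i * (p : ℤ) ^ (k i * b i) : ℤ) : ZMod (p ^ a)) * y i ^ k i := by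
    refine Finset.sum_congr rfl fun i _ => ?_
    push_cast
    rw [mul_pow, ← pow_mul, mul_comm (b i), mul_assoc]
  have hs : (p : ℚ) ^ (-(∑ j ∈ Finset.univ.filter (fun i => b i < a), (b j : ℤ))) =
      ∏ i, if b i < a then (p : ℚ) ^ (-(b i : ℤ)) else 1 := by
    rw [← Finset.prod_filter, ← Nat.cast_sum, zpow_neg, zpow_natCast, ← Finset.prod_pow_eq_pow_sum,
      ← Finset.prod_inv_distrib]
    simp
  have hcond : (∀ i, (i ∈ Finset.univ.filter (fun i => b i < a) →
        i ∈ J2 ∩ Finset.univ.filter (fun i => b i < a) → IsUnit (y i)) ∧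
        (i ∉ Finset.univ.filter (fun i => b i < a) → y i = 0)) ↔
      ∀ i, (b i < a → i ∈ J2 → IsUnit (y i)) ∧ (a ≤ b i → y i = 0) := by
    simp +contextual
  rw [prod_residueWeight, hQ, hs]
  simp only [hcond]
  split_ifs <;> simp_all
end

section
/- (Theorem B(1).) Let p be a prime, suppose Q is reduced at p, and let J ⊆ I be a nonempty subset with depth d_{p,J}. Then for all integers a ≥ d_{p,J} and all c ∈ ℤ, N_J(Q; c, p^a) = p^{(t−1)(a − d_{p,J})} · N_J(Q; c, p^{d_{p,J}}). -/
/-- The depth `d_{p,J}` of `Q = ∑ lam i * x i ^ k i` at the prime `p` associated to a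
nonempty subset `J`: `min_{i∈J}(v_p(λᵢkᵢ)+1)` for odd `p`, and for `p = 2` the minimum over
`i ∈ J` of `v₂(λᵢkᵢ)+2` if `kᵢ` is even and `v₂(λᵢkᵢ)+1` if `kᵢ` is odd. -/
def depth (p : ℕ) {t : ℕ} (lam : Fin t → ℤ) (k : Fin t → ℕ) (J : Finset (Fin t))
    (hJ : J.Nonempty) : ℕ :=
  J.inf' hJ fun i =>
    if p = 2 ∧ 2 ∣ k i then padicValInt p (lam i * (k i : ℤ)) + 2
    else padicValInt p (lam i * (k i : ℤ)) + 1

/-- Lifting the exponent for `1 + p ^ b`. -/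
theorem exists_one_add_pow_eq {p : ℕ} (hp : p.Prime) {k b : ℕ} (hk : k ≠ 0) (hb : b ≠ 0)
    (hb2 : p = 2 → 2 ∣ k → 2 ≤ b) :
    ∃ ε : ℤ, ¬ (p : ℤ) ∣ ε ∧ (1 + (p : ℤ) ^ b) ^ k = 1 + (p : ℤ) ^ (b + padicValNat p k) * ε := by
  have := Fact.mk hp
  have hpZ : Prime (p : ℤ) := Nat.prime_iff_prime_int.mp hp
  have hsub : (1 + (p : ℤ) ^ b) - 1 = (p : ℤ) ^ b := by ring
  have hdvd : (p : ℤ) ∣ (1 + (p : ℤ) ^ b) - 1 := by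
    rw [hsub]
    exact dvd_pow_self _ hb
  have hnd : ¬ (p : ℤ) ∣ 1 + (p : ℤ) ^ b := fun h =>
    hpZ.not_dvd_one ((dvd_add_left (dvd_pow_self _ hb)).mp h)
  have hval : emultiplicity (p : ℤ) ((1 + (p : ℤ) ^ b) ^ k - 1 ^ k)
      = emultiplicity (p : ℤ) ((1 + (p : ℤ) ^ b) - 1) + emultiplicity p k := by
    rcases hp.eq_two_or_odd' with rfl | hodd
    · by_cases h2 : 2 ∣ k
      · have h4 : (4 : ℤ) ∣ (1 + ((2 : ℕ) : ℤ) ^ b) - 1 := by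
          rw [hsub]
          exact pow_dvd_pow (2 : ℤ) (hb2 rfl h2)
        have := Int.two_pow_sub_pow' k h4 hnd
        rw [← Nat.cast_ofNat, Int.natCast_emultiplicity 2 k] at this
        exact this
      · rw [emultiplicity_pow_sub_pow_of_prime hpZ hdvd hnd (by exact_mod_cast h2),
          emultiplicity_eq_zero.mpr h2, add_zero]
    · exact Int.emultiplicity_pow_sub_pow hp hodd hdvd hnd k
  rw [hsub, ← padicValNat_eq_emultiplicity hk, emultiplicity_pow_self hpZ.ne_zero hpZ.not_isUnit,
    one_pow, ← Nat.cast_add, emultiplicity_eq_coe] at hval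
  obtain ⟨⟨ε, hε⟩, hlt⟩ := hval
  refine ⟨ε, ?_, by linear_combination hε⟩
  rintro ⟨δ, rfl⟩
  exact hlt ⟨δ, by rw [hε]; ring⟩

theorem Int.exists_dvd_add_mul_of_not_dvd {p : ℕ} (hp : p.Prime) {m : ℤ} (hm : ¬ (p : ℤ) ∣ m)
    (n : ℕ) (z : ℤ) : ∃ g : ℕ, (p : ℤ) ^ n ∣ m * g - z := by
  have hcop : IsCoprime m ((p : ℤ) ^ n) :=
    (((Nat.prime_iff_prime_int.mp hp).coprime_iff_not_dvd).mpr hm).symm.pow_right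
  obtain ⟨x, y, hxy⟩ := hcop
  have hpos : (0 : ℤ) < (p : ℤ) ^ n := by have := hp.pos; positivity
  refine ⟨((z * x) % (p : ℤ) ^ n).toNat, ?_⟩
  rw [Int.toNat_of_nonneg (Int.emod_nonneg _ hpos.ne'), Int.emod_def]
  exact ⟨-(z * y) - m * (z * x / (p : ℤ) ^ n), by linear_combination z * hxy⟩

/-- If `w` is sufficiently close to the `k`-th power of a `p`-adic unit, then it is a `k`-th power
modulo every power of `p`. -/
theorem exists_pow_lift {p : ℕ} (hp : p.Prime) {k q : ℕ} (hk : k ≠ 0) (hq : q ≠ 0)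
    (hq2 : p = 2 → 2 ∣ k → 2 ≤ q) {u : ℤ} (hu : ¬ (p : ℤ) ∣ u) (e : ℤ) (n : ℕ) :
    ∃ v : ℤ, ¬ (p : ℤ) ∣ v ∧
      (p : ℤ) ^ (padicValNat p k + q + n) ∣
        v ^ k - (u ^ k + (p : ℤ) ^ (padicValNat p k + q) * e) := by
  have hpZ : Prime (p : ℤ) := Nat.prime_iff_prime_int.mp hp
  induction n with
  | zero => exact ⟨u, hu, -e, by ring⟩
  | succ n ih =>
    obtain ⟨v, hv, f, hf⟩ := ih
    obtain ⟨ε, hε, hpow⟩ := exists_one_add_pow_eq hp hk (b := q + n) (by omega)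
      (fun h h' => (hq2 h h').trans (Nat.le_add_right _ _))
    obtain ⟨g, hg⟩ := Int.exists_dvd_add_mul_of_not_dvd hp
      (m := v ^ k * ε) (hpZ.dvd_mul.not.mpr (not_or.mpr ⟨fun h => hv (hpZ.dvd_of_dvd_pow h), hε⟩))
      1 (-f)
    rw [pow_one] at hg
    have hw : ¬ (p : ℤ) ∣ 1 + (p : ℤ) ^ (q + n) := fun h =>
      hpZ.not_dvd_one ((dvd_add_left (dvd_pow_self _ (by omega))).mp h)
    refine ⟨v * (1 + (p : ℤ) ^ (q + n)) ^ g,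
      hpZ.dvd_mul.not.mpr (not_or.mpr ⟨hv, fun h => hw (hpZ.dvd_of_dvd_pow h)⟩), ?_⟩
    rw [show q + n + padicValNat p k = padicValNat p k + q + n by ring] at hpow
    set A := padicValNat p k + q + n with hA
    obtain ⟨s, hs⟩ := sq_dvd_add_pow_sub_sub ((p : ℤ) ^ A * ε) 1 g
    obtain ⟨y, hy⟩ := hg
    have hexp : ((1 + (p : ℤ) ^ (q + n)) ^ g) ^ k
        = 1 + (p : ℤ) ^ A * ε * g + ((p : ℤ) ^ A * ε) ^ 2 * s := by
      rw [pow_right_comm, hpow]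
      simp only [one_pow, one_mul] at hs
      linear_combination hs
    have hA1 : (p : ℤ) ^ A = (p : ℤ) * (p : ℤ) ^ (A - 1) := by
      rw [← pow_succ', Nat.sub_add_cancel (by omega)]
    rw [mul_pow, hexp, ← add_assoc, ← hA, pow_succ]
    refine ⟨y + v ^ k * ε ^ 2 * s * (p : ℤ) ^ (A - 1), ?_⟩
    linear_combination hf + (p : ℤ) ^ A * hy + v ^ k * (p : ℤ) ^ A * ε ^ 2 * s * hA1

theorem isUnit_intCast_zmod_prime_pow {p : ℕ} (hp : p.Prime) {n : ℕ} (hn : n ≠ 0) (u : ℤ) :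
    IsUnit (u : ZMod (p ^ n)) ↔ ¬ (p : ℤ) ∣ u := by
  rw [ZMod.coe_int_isUnit_iff_isCoprime, Nat.cast_pow,
    IsCoprime.pow_left_iff (Nat.pos_of_ne_zero hn),
    (Nat.prime_iff_prime_int.mp hp).coprime_iff_not_dvd]

/-- Values of `l * x ^ k` at units of `ℤ/p^n` can be moved by multiples of
`p ^ (v_p(l * k) + q)`. -/
theorem exists_unit_mul_pow_eq_add {p : ℕ} (hp : p.Prime) {l : ℤ} (hl : l ≠ 0) {k q : ℕ}
    (hk : k ≠ 0) (hq : q ≠ 0) (hq2 : p = 2 → 2 ∣ k → 2 ≤ q) {n : ℕ}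
    (hn : padicValInt p (l * k) + q ≤ n) {e : ZMod (p ^ n)}
    (he : (p : ZMod (p ^ n)) ^ (padicValInt p (l * k) + q) ∣ e) {x : ZMod (p ^ n)}
    (hx : IsUnit x) :
    ∃ y : ZMod (p ^ n), IsUnit y ∧ (l : ZMod (p ^ n)) * y ^ k = l * x ^ k + e := by
  have := Fact.mk hp
  rw [padicValInt.mul hl (by exact_mod_cast hk), padicValInt.of_nat] at he hn
  obtain ⟨z, rfl⟩ := he
  obtain ⟨z, rfl⟩ := ZMod.intCast_surjective z
  obtain ⟨u, rfl⟩ := ZMod.intCast_surjective x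
  have hn0 : n ≠ 0 := by omega
  rw [isUnit_intCast_zmod_prime_pow hp hn0] at hx
  obtain ⟨l', hl'⟩ := padicValInt_dvd (p := p) l
  have hndvd : ¬ (p : ℤ) ∣ l' := by
    rintro ⟨m, rfl⟩
    have h := (padicValInt_dvd_iff (p := p) (padicValInt p l + 1) l).mp ⟨m, by
      rw [pow_succ, mul_assoc]; exact hl'⟩
    omega
  obtain ⟨g, hg⟩ := Int.exists_dvd_add_mul_of_not_dvd hp hndvd n z
  obtain ⟨v, hv, hpow⟩ := exists_pow_lift hp hk hq hq2 hx g n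
  refine ⟨v, (isUnit_intCast_zmod_prime_pow hp hn0 v).mpr hv, ?_⟩
  have key : ((p ^ n : ℕ) : ℤ) ∣
      (l * u ^ k + (p : ℤ) ^ (padicValInt p l + padicValNat p k + q) * z) - l * v ^ k := by
    obtain ⟨i, hi⟩ := hg
    obtain ⟨j, hj⟩ := hpow
    rw [Nat.cast_pow]
    refine ⟨-(p : ℤ) ^ (padicValInt p l + padicValNat p k + q) * i
      - l * (p : ℤ) ^ (padicValNat p k + q) * j, ?_⟩
    linear_combination -l * hj - (p : ℤ) ^ (padicValInt p l + padicValNat p k + q) * hi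
      - (p : ℤ) ^ (padicValNat p k + q) * g * hl'
  have h := (ZMod.intCast_eq_intCast_iff_dvd_sub _ _ _).mpr key
  push_cast at h
  exact h

/-- If the values of `l i * x ^ k i` at units can be translated by `e`, then there are at most as
many solutions for `c` as for `c + e`. -/
theorem card_solutions_le_add {R : Type*} [CommRing R] [Finite R] {t : ℕ} (l : Fin t → R)
    (k : Fin t → ℕ) (J : Finset (Fin t)) {i : Fin t} (hi : i ∈ J) (c e : R)
    (h : ∀ x : R, IsUnit x → ∃ y, IsUnit y ∧ l i * y ^ k i = l i * x ^ k i + e) :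
    Nat.card {x : Fin t → R // ∑ j, l j * x j ^ k j = c ∧ ∀ j ∈ J, IsUnit (x j)} ≤
      Nat.card {x : Fin t → R // ∑ j, l j * x j ^ k j = c + e ∧ ∀ j ∈ J, IsUnit (x j)} := by
  classical
  have hunif : ∀ m : R, ∃ w : R, IsUnit w ∧
      ∀ x, IsUnit x → l i * x ^ k i = m → l i * (x * w) ^ k i = m + e := by
    intro m
    by_cases hm : ∃ x, IsUnit x ∧ l i * x ^ k i = m
    · obtain ⟨_, ⟨x, rfl⟩, hxm⟩ := hm
      obtain ⟨y, hy, hye⟩ := h x x.isUnit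
      refine ⟨(x⁻¹ : Rˣ) * y, x⁻¹.isUnit.mul hy, fun z _ hzm => ?_⟩
      have hcancel : l i * (x : R) ^ k i * ((x⁻¹ : Rˣ) * y) ^ k i = l i * y ^ k i := by
        rw [mul_assoc, ← mul_pow, Units.mul_inv_cancel_left]
      rw [mul_pow, ← mul_assoc, hzm, ← hxm, hcancel, hye]
    · exact ⟨1, isUnit_one, fun x hx hxm => absurd ⟨x, hx, hxm⟩ hm⟩
  choose w hw hwe using hunif
  let φ : (Fin t → R) → Fin t → R := fun x =>
    Function.update x i (x i * w (l i * x i ^ k i))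
  have hsum : ∀ x : Fin t → R, ∑ j, l j * x j ^ k j
      = l i * x i ^ k i + ∑ j ∈ Finset.univ.erase i, l j * x j ^ k j := fun x =>
    (Finset.add_sum_erase _ _ (Finset.mem_univ i)).symm
  have hφ : ∀ x j, j ≠ i → φ x j = x j := fun x j hj => Function.update_of_ne hj _ _
  have hφi : ∀ x, φ x i = x i * w (l i * x i ^ k i) := fun x => Function.update_self _ _ _
  have hrest : ∀ x, ∑ j ∈ Finset.univ.erase i, l j * φ x j ^ k j
      = ∑ j ∈ Finset.univ.erase i, l j * x j ^ k j := fun x =>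
    Finset.sum_congr rfl fun j hj => by rw [hφ x j (Finset.ne_of_mem_erase hj)]
  refine Nat.card_le_card_of_injective
    (fun x => ⟨φ x.1, ?_, fun j hj => ?_⟩) ?_
  · have := x.2.1
    rw [hsum] at this ⊢
    rw [hrest, hφi, hwe _ _ (x.2.2 i hi) rfl]
    linear_combination this
  · by_cases hji : j = i
    · subst hji
      rw [hφi]
      exact (x.2.2 j hj).mul (hw _)
    · rw [hφ _ _ hji]
      exact x.2.2 j hj
  · rintro ⟨x, hx, hxu⟩ ⟨y, hy, hyu⟩ hxy
    have hxy : φ x = φ y := congrArg Subtype.val hxy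
    have hval : l i * x i ^ k i = l i * y i ^ k i := by
      rw [hsum, ← hrest] at hx hy
      rw [hxy] at hx
      linear_combination hx - hy
    refine Subtype.ext (funext fun j => ?_)
    by_cases hji : j = i
    · subst hji
      have := congrFun hxy j
      rw [hφi, hφi, hval] at this
      exact (hw _).mul_left_injective this
    · exact (hφ x j hji).symm.trans ((congrFun hxy j).trans (hφ y j hji))

/-- The preimage of a subset under a surjective homomorphism of finite groups. -/
theorem AddMonoidHom.card_preimage_mul_card {A B : Type*} [AddGroup A] [AddGroup B] [Finite A]
    [Finite B] (f : A →+ B) (hf : Function.Surjective f) (P : B → Prop) :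
    Nat.card {a // P (f a)} * Nat.card B = Nat.card {b // P b} * Nat.card A := by
  classical
  have := Fintype.ofFinite A
  have := Fintype.ofFinite B
  have hcard : ∀ Q : B → Prop, Nat.card {a // Q (f a)}
      = Nat.card {b // Q b} * (Finset.univ.filter fun a => f a = 0).card := by
    intro Q
    rw [Nat.card_eq_fintype_card, Nat.card_eq_fintype_card, Fintype.card_subtype,
      Fintype.card_subtype, Finset.card_eq_sum_card_fiberwise
        (f := f) (t := Finset.univ.filter Q) (fun a ha => by simpa using ha)]
    refine Finset.sum_const_nat fun b hb => ?_
    rw [Finset.filter_filter,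
      AddMonoidHom.card_fiber_eq_of_mem_range f (hf 0) (hf b)]
    congr 1
    ext a
    simp only [Finset.mem_filter, Finset.mem_univ, true_and] at hb ⊢
    exact ⟨And.right, fun h => ⟨h ▸ hb, h⟩⟩
  have htot := hcard fun _ => True
  rw [Nat.card_congr (Equiv.subtypeUnivEquiv fun _ => trivial),
    Nat.card_congr (Equiv.subtypeUnivEquiv fun _ => trivial)] at htot
  rw [hcard P, htot]
  ring

/-- Theorem B(1): if `Q` is reduced at `p` and `J` is nonempty, then for all `a ≥ d_{p,J}`
and all `c ∈ ℤ`, `N_J(Q; c, p^a) = p^{(t-1)(a-d_{p,J})} N_J(Q; c, p^{d_{p,J}})`. -/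
theorem lifting_formula (t : ℕ) (ht : 1 ≤ t) (lam : Fin t → ℤ) (hlam : ∀ i, lam i ≠ 0)
    (k : Fin t → ℕ) (hk : ∀ i, 1 ≤ k i) (p : ℕ) (hp : p.Prime)
    (hred : ∃ i, ¬ ((p : ℤ) ∣ lam i)) (J : Finset (Fin t)) (hJ : J.Nonempty)
    (a : ℕ) (ha : depth p lam k J hJ ≤ a) (c : ℤ) :
    NJ lam k J c (p ^ a) =
      p ^ ((t - 1) * (a - depth p lam k J hJ)) * NJ lam k J c (p ^ depth p lam k J hJ) := by
  have := Fact.mk hp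
  obtain ⟨i, hi, hdi⟩ := Finset.exists_mem_eq_inf' hJ fun i =>
    if p = 2 ∧ 2 ∣ k i then padicValInt p (lam i * (k i : ℤ)) + 2
    else padicValInt p (lam i * (k i : ℤ)) + 1
  obtain ⟨q, hq, hq2, hd⟩ : ∃ q, q ≠ 0 ∧ (p = 2 → 2 ∣ k i → 2 ≤ q) ∧
      depth p lam k J hJ = padicValInt p (lam i * (k i : ℤ)) + q := by
    by_cases h : p = 2 ∧ 2 ∣ k i
    · exact ⟨2, by omega, fun _ _ => le_rfl, by rw [depth, hdi, if_pos h]⟩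
    · exact ⟨1, by omega, fun h₁ h₂ => absurd ⟨h₁, h₂⟩ h, by rw [depth, hdi, if_neg h]⟩
  set d := depth p lam k J hJ
  have hd0 : d ≠ 0 := by omega
  have ha0 : a ≠ 0 := by omega
  have hdvd : p ^ d ∣ p ^ a := pow_dvd_pow p ha
  let f := ZMod.castHom hdvd (ZMod (p ^ d))
  have hf : Function.Surjective f := ZMod.castHom_surjective hdvd
  let S : ZMod (p ^ a) → ℕ := fun y => Nat.card {x : Fin t → ZMod (p ^ a) //
    (∑ i, (lam i : ZMod (p ^ a)) * x i ^ k i) = y ∧ ∀ j ∈ J, IsUnit (x j)}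
  have hle : ∀ y y', f y = f y' → S y ≤ S y' := by
    intro y y' hyy
    have hdiv : (p : ZMod (p ^ a)) ^ d ∣ y' - y := by
      obtain ⟨z, hz⟩ := ZMod.intCast_surjective (y' - y)
      have h0 : f (y' - y) = 0 := by rw [map_sub, hyy, sub_self]
      rw [← hz, map_intCast, ZMod.intCast_zmod_eq_zero_iff_dvd] at h0
      rw [← hz]
      have := map_dvd (Int.castRingHom (ZMod (p ^ a))) h0
      simpa using this
    have := card_solutions_le_add (fun j => (lam j : ZMod (p ^ a))) k J hi y (y' - y)
      fun x hx => exists_unit_mul_pow_eq_add hp (hlam i) (Nat.one_le_iff_ne_zero.mp (hk i)) hq hq2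
        (hd ▸ ha) (hd ▸ hdiv) hx
    rwa [add_sub_cancel] at this
  have hunit : ∀ y, IsUnit (f y) ↔ IsUnit y := by
    intro y
    obtain ⟨z, rfl⟩ := ZMod.intCast_surjective y
    rw [map_intCast, isUnit_intCast_zmod_prime_pow hp hd0, isUnit_intCast_zmod_prime_pow hp ha0]
  have htuples := (f.toAddMonoidHom.compLeft (Fin t)).card_preimage_mul_card
    hf.comp_left fun x => (∑ i, (lam i : ZMod (p ^ d)) * x i ^ k i) = (c : ZMod (p ^ d)) ∧
      ∀ j ∈ J, IsUnit (x j)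
  have hfiber := f.toAddMonoidHom.card_preimage_mul_card hf fun y => y = (c : ZMod (p ^ d))
  have hmap : ∀ x : Fin t → ZMod (p ^ a), (∑ i, (lam i : ZMod (p ^ d)) * f (x i) ^ k i)
      = f (∑ i, (lam i : ZMod (p ^ a)) * x i ^ k i) := fun x => by
    simp only [map_sum, map_mul, map_pow, map_intCast]
  let E : {x : Fin t → ZMod (p ^ a) // (∑ i, (lam i : ZMod (p ^ d)) * f (x i) ^ k i) = c ∧
        ∀ j ∈ J, IsUnit (f (x j))} ≃
      Σ y : {y : ZMod (p ^ a) // f y = c}, {x : Fin t → ZMod (p ^ a) //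
        (∑ i, (lam i : ZMod (p ^ a)) * x i ^ k i) = y ∧ ∀ j ∈ J, IsUnit (x j)} :=
    { toFun := fun x => ⟨⟨_, (hmap x.1).symm.trans x.2.1⟩, x.1, rfl,
        fun j hj => (hunit _).mp (x.2.2 j hj)⟩
      invFun := fun z => ⟨z.2.1, by rw [hmap, z.2.2.1, z.1.2],
        fun j hj => (hunit _).mpr (z.2.2.2 j hj)⟩
      left_inv := fun _ => rfl
      right_inv := by
        rintro ⟨⟨y, hy⟩, x, hxy, hx⟩
        change _ = y at hxy
        subst hxy
        rfl }
  have hsum : Nat.card {x : Fin t → ZMod (p ^ a) //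
      (∑ i, (lam i : ZMod (p ^ d)) * f (x i) ^ k i) = c ∧ ∀ j ∈ J, IsUnit (f (x j))}
      = Nat.card {y : ZMod (p ^ a) // f y = c} * NJ lam k J c (p ^ a) := by
    have := Fintype.ofFinite {y : ZMod (p ^ a) // f y = c}
    have hS : ∀ y : {y : ZMod (p ^ a) // f y = c}, S y = NJ lam k J c (p ^ a) := fun y => by
      have hy : f y = f (c : ZMod (p ^ a)) := by rw [y.2, map_intCast]
      exact (hle _ _ hy).antisymm (hle _ _ hy.symm)
    rw [Nat.card_congr E, Nat.card_sigma, Finset.sum_const_nat fun y _ => hS y,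
      Finset.card_univ, Nat.card_eq_fintype_card]
  replace htuples : Nat.card {y : ZMod (p ^ a) // f y = c} * NJ lam k J c (p ^ a) * (p ^ d) ^ t
      = NJ lam k J c (p ^ d) * (p ^ a) ^ t := by
    rw [← hsum]
    simpa [Nat.card_fun, NJ] using htuples
  replace hfiber : Nat.card {y : ZMod (p ^ a) // f y = c} * p ^ d = p ^ a := by
    simpa using hfiber
  obtain ⟨b, hb⟩ := Nat.exists_eq_add_of_le ha
  obtain ⟨s, rfl⟩ := Nat.exists_eq_add_of_le' ht
  have hpos := hp.pos
  have hfib : Nat.card {y : ZMod (p ^ a) // f y = c} = p ^ b :=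
    Nat.eq_of_mul_eq_mul_right (pow_pos hpos d) (by rw [hfiber, hb]; ring)
  rw [hfib] at htuples
  rw [hb] at htuples ⊢
  rw [Nat.add_sub_cancel_left, Nat.add_sub_cancel]
  refine Nat.eq_of_mul_eq_mul_left (show 0 < p ^ b * (p ^ d) ^ (s + 1) by positivity) ?_
  linear_combination htuples
end

section
/- (Lowering degree, Proposition 2.1(3).) Let p be a prime, a ≥ 1, c ∈ ℤ, and J ⊆ I. Suppose v_p(k_i) ≥ a for some i ∈ I, and let Q' be the polynomial obtained from Q by replacing the exponent k_i with k_i' = k_i / p^{v_p(k_i) − a + 1} (so that v_p(k_i') = a − 1). Then N_J(Q; c, p^a) = N_J(Q'; c, p^a). -/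
/-- The power map `x ↦ x ^ p ^ n` on `ℤ / p ^ (n + 1)` is unchanged when `n` is raised by one. -/
lemma ZMod.pow_prime_pow_succ {p : ℕ} (hp : p.Prime) (n : ℕ) (x : ZMod (p ^ (n + 1))) :
    x ^ p ^ (n + 1) = x ^ p ^ n := by
  have := Fact.mk hp
  obtain ⟨y, rfl⟩ := ZMod.intCast_surjective x
  have h : (p : ℤ) ∣ y ^ p - y := by
    rw [← ZMod.intCast_zmod_eq_zero_iff_dvd]
    simp [ZMod.pow_card]
  have h' := dvd_sub_pow_of_dvd_sub h n
  rw [← pow_mul, ← pow_succ'] at h'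
  rw [← sub_eq_zero]
  have h'' := (ZMod.intCast_zmod_eq_zero_iff_dvd (y ^ p ^ (n + 1) - y ^ p ^ n) (p ^ (n + 1))).2
    (by exact_mod_cast h')
  simpa using h''

lemma ZMod.pow_prime_pow_add {p : ℕ} (hp : p.Prime) (n s : ℕ) (x : ZMod (p ^ (n + 1))) :
    x ^ p ^ (n + s) = x ^ p ^ n := by
  induction s with
  | zero => rfl
  | succ s ih =>
    rw [← Nat.add_assoc, pow_succ p (n + s), pow_mul, ih, ← pow_mul, ← pow_succ p n,
      pow_prime_pow_succ hp]

lemma ZMod.pow_eq_pow_div_prime_pow {p : ℕ} (hp : p.Prime) {a k : ℕ} (ha : 1 ≤ a)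
    (hk : a ≤ padicValNat p k) (x : ZMod (p ^ a)) :
    x ^ k = x ^ (k / p ^ (padicValNat p k - a + 1)) := by
  obtain ⟨n, rfl⟩ : ∃ n, a = n + 1 := ⟨a - 1, by omega⟩
  obtain ⟨m, hm⟩ := pow_padicValNat_dvd (p := p) (n := k)
  set s := padicValNat p k - (n + 1) + 1 with hs
  have hv : padicValNat p k = n + s := by omega
  rw [hv] at hm
  have hdiv : k / p ^ s = p ^ n * m := by
    rw [hm]
    exact Nat.div_eq_of_eq_mul_left (pow_pos hp.pos s) (by ring)
  rw [hdiv, hm, pow_mul, pow_mul, pow_prime_pow_add hp]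

/-- Lowering degree (Proposition 2.1(3)): if `v_p(k_i) ≥ a` and `Q'` is obtained from `Q` by
replacing the exponent `k_i` with `k_i' = k_i / p^{v_p(k_i) - a + 1}`, then
`N_J(Q; c, p^a) = N_J(Q'; c, p^a)`. -/
theorem lowering_degree (t : ℕ) (ht : 1 ≤ t) (lam : Fin t → ℤ) (hlam : ∀ i, lam i ≠ 0)
    (k : Fin t → ℕ) (hk : ∀ i, 1 ≤ k i) (p : ℕ) (hp : p.Prime) (a : ℕ) (ha : 1 ≤ a)
    (c : ℤ) (J : Finset (Fin t)) (i : Fin t) (hi : a ≤ padicValNat p (k i)) :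
    NJ lam k J c (p ^ a) =
      NJ lam (fun j => if j = i then k i / p ^ (padicValNat p (k i) - a + 1) else k j)
        J c (p ^ a) := by
  have hpow (x : Fin t → ZMod (p ^ a)) (j : Fin t) :
      x j ^ (if j = i then k i / p ^ (padicValNat p (k i) - a + 1) else k j) = x j ^ k j := by
    split_ifs with h
    · subst h
      exact (ZMod.pow_eq_pow_div_prime_pow hp ha hi (x j)).symm
    · rfl
  simp only [NJ, hpow]
end

section
/- (Lemma 3.1(1).) Let p be an odd prime. For all integers x, y and all integers k ≥ 1 and m ≥ 1, one has (x + p^m y)^k ≡ x^k + k x^{k−1} y p^m (mod p^{m + v_p(k) + 1}), where v_p(k) is the p-adic valuation of k. -/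
/-- For `i ≠ 0`, the power of `p` dividing `k` divides `p ^ v_p(i) * k.choose i`. -/
theorem pow_padicValNat_dvd_pow_mul_choose {p : ℕ} (hp : p.Prime) (k : ℕ) {i : ℕ} (hi : i ≠ 0) :
    p ^ padicValNat p k ∣ p ^ padicValNat p i * k.choose i := by
  have := Fact.mk hp
  obtain _ | n := k
  · simp [Nat.choose_eq_zero_of_lt (Nat.pos_of_ne_zero hi)]
  obtain ⟨j, rfl⟩ := Nat.exists_eq_succ_of_ne_zero hi
  obtain ⟨c, hc⟩ : p ^ padicValNat p (j + 1) ∣ j + 1 := pow_padicValNat_dvd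
  have hpc : ¬ p ∣ c := by
    rintro ⟨d, rfl⟩
    refine pow_succ_padicValNat_not_dvd (p := p) hi ⟨d, ?_⟩
    rw [pow_succ, mul_assoc]
    exact hc
  have hdvd : p ^ padicValNat p (n + 1) ∣
      (p ^ padicValNat p (j + 1) * (n + 1).choose (j + 1)) * c := by
    rw [mul_right_comm, ← hc, mul_comm, ← Nat.add_one_mul_choose_eq]
    exact pow_padicValNat_dvd.mul_right _
  exact (((Nat.Prime.coprime_iff_not_dvd hp).2 hpc).pow_left _).dvd_of_dvd_mul_right hdvd

theorem padicValNat_add_two_le {p : ℕ} (hp : 3 ≤ p) {i : ℕ} (hi : 2 ≤ i) :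
    padicValNat p i + 2 ≤ i := by
  have hle : 3 ^ padicValNat p i ≤ i :=
    (Nat.pow_le_pow_left hp _).trans (Nat.le_of_dvd (by omega) pow_padicValNat_dvd)
  have hbern : ∀ b : ℕ, 2 * b + 1 ≤ 3 ^ b := fun b => by
    induction b with
    | zero => simp
    | succ b ih => rw [pow_succ]; omega
  have := hbern (padicValNat p i)
  omega

theorem pow_dvd_choose_mul_pow_mul {p : ℕ} (hp : p.Prime) (hodd : p ≠ 2) (k : ℕ) {m i : ℕ}
    (hm : 1 ≤ m) (hi : 2 ≤ i) :
    p ^ (m + padicValNat p k + 1) ∣ k.choose i * p ^ (m * i) := by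
  have hb := padicValNat_add_two_le (p := p) (by have := hp.two_le; omega) hi
  have hexp : padicValNat p i + (m + 1) ≤ m * i := by
    obtain ⟨u, rfl⟩ := Nat.exists_eq_add_of_le hm
    nlinarith [Nat.mul_le_mul_left u (show 1 ≤ i by omega)]
  calc p ^ (m + padicValNat p k + 1)
      = p ^ padicValNat p k * p ^ (m + 1) := by rw [← pow_add]; congr 1; omega
    _ ∣ (p ^ padicValNat p i * k.choose i) * p ^ (m + 1) :=
        mul_dvd_mul_right (pow_padicValNat_dvd_pow_mul_choose hp k (by omega)) _
    _ = k.choose i * p ^ (padicValNat p i + (m + 1)) := by rw [pow_add]; ring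
    _ ∣ k.choose i * p ^ (m * i) := mul_dvd_mul_left _ (pow_dvd_pow _ hexp)

/-- Lemma 3.1(1): for an odd prime `p`, integers `x, y` and integers `k ≥ 1`, `m ≥ 1`,
`(x + p^m y)^k ≡ x^k + k x^{k-1} y p^m (mod p^{m + v_p(k) + 1})`. -/
theorem binomial_congruence (p : ℕ) (hp : p.Prime) (hodd : p ≠ 2) (x y : ℤ) (k m : ℕ)
    (hk : 1 ≤ k) (hm : 1 ≤ m) :
    (x + (p : ℤ) ^ m * y) ^ k ≡
      x ^ k + (k : ℤ) * x ^ (k - 1) * y * (p : ℤ) ^ m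
        [ZMOD (p : ℤ) ^ (m + padicValNat p k + 1)] := by
  have hdvd : ∀ i : ℕ, (p : ℤ) ^ (m + padicValNat p k + 1) ∣
      ((p : ℤ) ^ m * y) ^ (i + 2) * x ^ (k - (i + 2)) * (k.choose (i + 2) : ℤ) := fun i => by
    have h : (p : ℤ) ^ (m + padicValNat p k + 1) ∣
        (k.choose (i + 2) : ℤ) * (p : ℤ) ^ (m * (i + 2)) := by
      exact_mod_cast pow_dvd_choose_mul_pow_mul hp hodd k hm (Nat.le_add_left 2 i)
    refine (h.mul_right (y ^ (i + 2) * x ^ (k - (i + 2)))).trans (dvd_of_eq ?_)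
    rw [mul_pow, ← pow_mul]
    ring
  refine (Int.modEq_iff_dvd.2 ?_).symm
  obtain ⟨n, rfl⟩ := Nat.exists_eq_add_of_le' hk
  rw [add_comm x, add_pow, Finset.sum_range_succ', Finset.sum_range_succ']
  refine (Finset.dvd_sum (s := Finset.range n) fun i _ => hdvd i).trans (dvd_of_eq ?_)
  simp only [Nat.choose_zero_right, Nat.choose_one_right, zero_add, pow_zero, pow_one,
    Nat.sub_zero, add_assoc, Nat.reduceAdd]
  push_cast
  ring
end

section
/- (Corollary to Theorem B.) Let p be a prime and suppose the depth d_p = d_{p,I} of Q at p satisfies d_p ≥ t. Then there exists an integer c such that N*(Q; c, p^{d_p}) = 0, i.e., the congruence Q(x₁,…,xₜ) ≡ c (mod p^{d_p}) has no solution with all coordinates xᵢ units of ℤ/p^{d_p}ℤ. -/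
theorem two_pow_add_three_dvd_sub_of_odd {a b : ℤ} (ha : Odd a) (hb : Odd b) (n : ℕ) :
    2 ^ (n + 3) ∣ a ^ 2 ^ (n + 1) - b ^ 2 ^ (n + 1) := by
  induction n with
  | zero =>
    have h := dvd_sub (Int.eight_dvd_sq_sub_one_of_odd ha) (Int.eight_dvd_sq_sub_one_of_odd hb)
    simpa using h
  | succ n ih =>
    have h2 : (2 : ℤ) ∣ a ^ 2 ^ (n + 1) + b ^ 2 ^ (n + 1) :=
      even_iff_two_dvd.mp (ha.pow.add_odd hb.pow)
    have h := mul_dvd_mul ih h2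
    rw [← pow_succ, mul_comm, ← sq_sub_sq, ← pow_mul, ← pow_mul, ← pow_succ] at h
    exact h

theorem pow_padicValNat_add_one_dvd {p : ℕ} [Fact p.Prime] {k : ℕ} {a b : ℤ}
    (h : (p : ℤ) ∣ a - b) :
    (p : ℤ) ^ (padicValNat p k + 1) ∣ a ^ k - b ^ k := by
  obtain ⟨m, hm⟩ := pow_padicValNat_dvd (p := p) (n := k)
  have h1 := dvd_sub_pow_of_dvd_sub h (padicValNat p k)
  have h2 := h1.trans (sub_dvd_pow_sub_pow _ _ m)
  rwa [← pow_mul, ← pow_mul, ← hm] at h2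

theorem two_pow_padicValNat_add_two_dvd {k : ℕ} (hk : k ≠ 0) (h2k : 2 ∣ k) {a b : ℤ}
    (ha : Odd a) (hb : Odd b) :
    (2 : ℤ) ^ (padicValNat 2 k + 2) ∣ a ^ k - b ^ k := by
  obtain ⟨m, hm⟩ := pow_padicValNat_dvd (p := 2) (n := k)
  obtain ⟨n, hn⟩ : ∃ n, padicValNat 2 k = n + 1 :=
    Nat.exists_eq_add_of_le' (one_le_padicValNat_of_dvd hk h2k)
  rw [hn] at hm ⊢
  have h2 := (two_pow_add_three_dvd_sub_of_odd ha hb n).trans (sub_dvd_pow_sub_pow _ _ m)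
  rwa [← pow_mul, ← pow_mul, ← hm] at h2

/-- Modulo `p ^ d`, with `d` at most the local depth of a monomial, the value of the monomial at
an integer prime to `p` depends only on the residue of that integer modulo `p`. -/
theorem pow_dvd_mul_pow_sub_pow {p : ℕ} [Fact p.Prime] {l : ℤ} (hl : l ≠ 0) {k : ℕ} (hk : k ≠ 0)
    {d : ℕ} (hd : d ≤ if p = 2 ∧ 2 ∣ k then padicValInt p (l * (k : ℤ)) + 2
      else padicValInt p (l * (k : ℤ)) + 1)
    {a b : ℤ} (ha : ¬ (p : ℤ) ∣ a) (hb : ¬ (p : ℤ) ∣ b) (hab : (p : ℤ) ∣ a - b) :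
    (p : ℤ) ^ d ∣ l * (a ^ k - b ^ k) := by
  rw [padicValInt.mul hl (by exact_mod_cast hk), padicValInt.of_nat] at hd
  have hl' : (p : ℤ) ^ padicValInt p l ∣ l := padicValInt_dvd l
  split_ifs at hd with h
  · obtain ⟨rfl, h2⟩ := h
    have ha' : Odd a := by rwa [← Int.not_even_iff_odd, even_iff_two_dvd]
    have hb' : Odd b := by rwa [← Int.not_even_iff_odd, even_iff_two_dvd]
    refine (pow_dvd_pow _ hd).trans ?_
    rw [add_assoc, pow_add]
    exact mul_dvd_mul hl' (two_pow_padicValNat_add_two_dvd hk h2 ha' hb')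
  · refine (pow_dvd_pow _ hd).trans ?_
    rw [add_assoc, pow_add]
    exact mul_dvd_mul hl' (pow_padicValNat_add_one_dvd hab)

theorem mul_pow_eq_mul_val_unitsMap_pow {p : ℕ} [Fact p.Prime] {l : ℤ} (hl : l ≠ 0) {k : ℕ}
    (hk : k ≠ 0) {d : ℕ} (hd0 : d ≠ 0)
    (hd : d ≤ if p = 2 ∧ 2 ∣ k then padicValInt p (l * (k : ℤ)) + 2
      else padicValInt p (l * (k : ℤ)) + 1) (u : (ZMod (p ^ d))ˣ) :
    (l : ZMod (p ^ d)) * (u : ZMod (p ^ d)) ^ k =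
      l * (((ZMod.unitsMap (dvd_pow_self p hd0) u : (ZMod p)ˣ) : ZMod p).val : ZMod (p ^ d)) ^ k
    := by
  have hp : p.Prime := Fact.out
  have : NeZero (p ^ d) := ⟨pow_ne_zero _ hp.ne_zero⟩
  set r : (ZMod p)ˣ := ZMod.unitsMap (dvd_pow_self p hd0) u with hr
  have hcast : (((u : ZMod (p ^ d)).val : ℕ) : ZMod p) = r := by
    rw [hr, ZMod.unitsMap_val, ZMod.natCast_val]
  have hcast' : (((r : ZMod p).val : ℕ) : ZMod p) = r := ZMod.natCast_zmod_val _
  have key := pow_dvd_mul_pow_sub_pow hl hk hd (a := (u : ZMod (p ^ d)).val)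
    (b := (r : ZMod p).val)
    (by rw [← ZMod.intCast_zmod_eq_zero_iff_dvd, Int.cast_natCast, hcast]; exact r.ne_zero)
    (by rw [← ZMod.intCast_zmod_eq_zero_iff_dvd, Int.cast_natCast, hcast']; exact r.ne_zero)
    (by
      rw [← ZMod.intCast_zmod_eq_zero_iff_dvd, Int.cast_sub, Int.cast_natCast, Int.cast_natCast,
        hcast, hcast', sub_self])
  have h := (ZMod.intCast_zmod_eq_zero_iff_dvd _ (p ^ d)).mpr (by exact_mod_cast key)
  rw [← sub_eq_zero, ← mul_sub]
  simpa using h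

/-- Corollary to Theorem B: if the depth `d_p = d_{p,I}` of `Q` at `p` satisfies `d_p ≥ t`,
then there exists `c ∈ ℤ` such that `N*(Q; c, p^{d_p}) = 0`. -/
theorem exists_no_unit_solution (t : ℕ) (ht : 1 ≤ t) (lam : Fin t → ℤ)
    (hlam : ∀ i, lam i ≠ 0) (k : Fin t → ℕ) (hk : ∀ i, 1 ≤ k i) (p : ℕ) (hp : p.Prime)
    (hd : t ≤ depth p lam k Finset.univ (Finset.univ_nonempty_iff.mpr ⟨⟨0, ht⟩⟩)) :
    ∃ c : ℤ,
      NJ lam k Finset.univ c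
        (p ^ depth p lam k Finset.univ (Finset.univ_nonempty_iff.mpr ⟨⟨0, ht⟩⟩)) = 0 := by
  have : Fact p.Prime := ⟨hp⟩
  have hdi : ∀ i, depth p lam k Finset.univ (Finset.univ_nonempty_iff.mpr ⟨⟨0, ht⟩⟩) ≤ _ :=
    fun i => Finset.inf'_le _ (Finset.mem_univ i)
  generalize depth p lam k Finset.univ (Finset.univ_nonempty_iff.mpr ⟨⟨0, ht⟩⟩) = d at hd hdi ⊢
  have hd0 : d ≠ 0 := by omega
  have : NeZero (p ^ d) := ⟨pow_ne_zero _ hp.ne_zero⟩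
  let F : (Fin t → (ZMod p)ˣ) → ZMod (p ^ d) := fun r =>
    ∑ i, (lam i : ZMod (p ^ d)) * ((r i : ZMod p).val : ZMod (p ^ d)) ^ k i
  have hF : ¬ Function.Surjective F := by
    intro hsurj
    have hcard := Fintype.card_le_of_surjective F hsurj
    rw [Fintype.card_fun, ZMod.card_units, ZMod.card, Fintype.card_fin] at hcard
    have h1 : (p - 1) ^ t < p ^ t :=
      Nat.pow_lt_pow_left (Nat.sub_lt hp.pos one_pos) (by omega)
    exact absurd (hcard.trans_lt h1) (Nat.pow_le_pow_right hp.pos hd).not_gt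
  simp only [Function.Surjective, not_forall, not_exists] at hF
  obtain ⟨c, hc⟩ := hF
  refine ⟨(c.val : ℤ), ?_⟩
  rw [NJ, Nat.card_eq_zero]
  left
  refine ⟨fun ⟨x, hx, hu⟩ => ?_⟩
  choose u hxu using fun i => hu i (Finset.mem_univ i)
  refine hc (fun i => ZMod.unitsMap (dvd_pow_self p hd0) (u i)) ?_
  rw [Int.cast_natCast, ZMod.natCast_zmod_val] at hx
  rw [← hx]
  refine Finset.sum_congr rfl fun i _ => ?_
  rw [← hxu i]
  exact (mul_pow_eq_mul_val_unitsMap_pow (hlam i) (by have := hk i; omega) hd0 (hdi i) (u i)).symm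
end

section
/- (Theorem 4.2, equation (kkk2).) Let Q(x₁,…,xₜ) = λ₁x₁^k + ⋯ + λₜxₜ^k with a common exponent k ≥ 1, and let p be a prime with p ∤ k and p ∤ λᵢ for some i ∈ I. Let I_p = {i ∈ I : p ∤ λᵢ} and t_p = |I_p|. Then for every integer c with p ∤ c and every a ≥ 1, N(Q; c, p^a) = p^{(a−1)(t−1)} · N(Q; c, p) = p^{at − a − t_p + 1} · N(Q_{I_p}; c, p), where N(Q_{I_p}; c, p) counts the solutions in (ℤ/pℤ)^{I_p} of Σ_{j∈I_p} λ_j x_j^k ≡ c (mod p). -/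
open Finset in
/-- The geometric sum `∑ x ^ i * y ^ (k - 1 - i)` is a unit when `x` and `y` agree modulo the kernel
of a local homomorphism to a field in which `k` and the common image are nonzero. -/
theorem isUnit_geom_sum₂_of_map_eq {R F : Type*} [CommRing R] [Field F] (f : R →+* F)
    [IsLocalHom f] {k : ℕ} (hk : (k : F) ≠ 0) {u : F} (hu : u ≠ 0) {x y : R} (hx : f x = u)
    (hy : f y = u) : IsUnit (∑ i ∈ range k, x ^ i * y ^ (k - 1 - i)) := by
  apply isUnit_of_map_unit f
  rw [f.map_geom_sum₂, hx, hy, geom_sum₂_self, isUnit_iff_ne_zero]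
  exact mul_ne_zero hk (pow_ne_zero _ hu)

/-- All fibres of a surjective ring homomorphism have the cardinality of its kernel. -/
theorem natCard_fiber_eq_natCard_ker {R F : Type*} [CommRing R] [Field F] (f : R →+* F)
    (hf : Function.Surjective f) (u : F) :
    Nat.card {r : R // f r = u} = Nat.card {r : R // f r = 0} := by
  obtain ⟨s, rfl⟩ := hf u
  exact Nat.card_congr ((Equiv.subRight s).subtypeEquiv fun r => by simp [sub_eq_zero])

theorem natCard_eq_natCard_mul_natCard_ker {R F : Type*} [CommRing R] [Finite R] [Field F]
    [Finite F] (f : R →+* F) (hf : Function.Surjective f) :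
    Nat.card R = Nat.card F * Nat.card {r : R // f r = 0} := by
  have := Fintype.ofFinite F
  rw [← Nat.card_congr (Equiv.sigmaFiberEquiv f), Nat.card_sigma]
  simp [natCard_fiber_eq_natCard_ker f hf]

/-- Hensel-type statement: `k`-th powering is a bijection from the fibre over `u` to the fibre over
`u ^ k`. -/
theorem existsUnique_pow_eq_of_map_eq {R F : Type*} [CommRing R] [Finite R] [Field F]
    (f : R →+* F) (hf : Function.Surjective f) [IsLocalHom f] {k : ℕ} (hk : (k : F) ≠ 0) {u : F}
    (hu : u ≠ 0) {w : R} (hw : f w = u ^ k) : ∃! r : R, f r = u ∧ r ^ k = w := by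
  let g : {r : R // f r = u} → {r : R // f r = u ^ k} := fun r => ⟨r.1 ^ k, by simp [r.2]⟩
  have hg : Function.Injective g := by
    rintro ⟨x, hx⟩ ⟨y, hy⟩ h
    have h' : x ^ k = y ^ k := congrArg Subtype.val h
    have h0 := (Commute.all x y).geom_sum₂_mul k
    rw [h', sub_self] at h0
    exact Subtype.ext (sub_eq_zero.mp
      ((isUnit_geom_sum₂_of_map_eq f hk hu hx hy).mul_right_eq_zero.mp h0))
  have hbij : Function.Bijective g := (Nat.bijective_iff_injective_and_card g).mpr
    ⟨hg, by rw [natCard_fiber_eq_natCard_ker f hf, natCard_fiber_eq_natCard_ker f hf (u ^ k)]⟩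
  obtain ⟨r, hr, hr'⟩ := hbij.existsUnique ⟨w, hw⟩
  exact ⟨r.1, ⟨r.2, congrArg Subtype.val hr⟩,
    fun y hy => congrArg Subtype.val (hr' ⟨y, hy.1⟩ (Subtype.ext hy.2))⟩

/-- The number of lifts to `R` of a nonsingular solution over `F` of a diagonal equation. -/
theorem natCard_lifts_of_nonsingular {R F ι : Type*} [CommRing R] [Finite R] [Field F] [Fintype ι]
    [DecidableEq ι] (f : R →+* F) (hf : Function.Surjective f) [IsLocalHom f] {k : ℕ}
    (hk : (k : F) ≠ 0) (l : ι → R) (c : R) (v : ι → F) (hv : ∑ i, f (l i) * v i ^ k = f c) (i : ι)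
    (hl : f (l i) ≠ 0) (hi : v i ≠ 0) :
    Nat.card {x : ι → R // ∑ j, l j * x j ^ k = c ∧ ∀ j, f (x j) = v j} =
      Nat.card {r : R // f r = 0} ^ (Fintype.card ι - 1) := by
  let g : {x : ι → R // ∑ j, l j * x j ^ k = c ∧ ∀ j, f (x j) = v j} →
      ∀ j : {j : ι // j ≠ i}, {r : R // f r = v j} := fun x j => ⟨x.1 j, x.2.2 j⟩
  obtain ⟨b, hb⟩ := isUnit_of_map_unit f _ (isUnit_iff_ne_zero.mpr hl)
  have hg : Function.Bijective g := by
    constructor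
    · rintro ⟨x, hx, hx'⟩ ⟨y, hy, hy'⟩ h
      have hne : ∀ j, j ≠ i → x j = y j := fun j hj =>
        congrArg Subtype.val (congrFun h ⟨j, hj⟩)
      have hp : x i ^ k = y i ^ k := by
        have h1 := hx.trans hy.symm
        rw [← Finset.add_sum_erase _ _ (Finset.mem_univ i),
          ← Finset.add_sum_erase _ (fun j => l j * y j ^ k) (Finset.mem_univ i),
          Finset.sum_congr rfl fun j hj => by rw [hne j (Finset.ne_of_mem_erase hj)]] at h1
        rw [← hb] at h1
        exact b.isUnit.mul_left_cancel (add_right_cancel h1)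
      refine Subtype.ext (funext fun j => ?_)
      by_cases hj : j = i
      · subst hj
        exact (existsUnique_pow_eq_of_map_eq f hf hk hi (w := y j ^ k) (by simp [hy'])).unique
          ⟨hx' j, hp⟩ ⟨hy' j, rfl⟩
      · exact hne j hj
    · intro y
      let z : ι → R := fun j => if h : j ≠ i then (y ⟨j, h⟩).1 else 0
      have hz : ∀ j, j ≠ i → f (z j) = v j := fun j hj => by
        simpa [z, hj] using (y ⟨j, hj⟩).2
      have hw : f (↑b⁻¹ * (c - ∑ j ∈ Finset.univ.erase i, l j * z j ^ k)) = v i ^ k := by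
        have h1 : f (↑b⁻¹ : R) * f (l i) = 1 := by rw [← hb, ← map_mul]; simp
        have h2 : f (∑ j ∈ Finset.univ.erase i, l j * z j ^ k) =
            ∑ j ∈ Finset.univ.erase i, f (l j) * v j ^ k := by
          rw [map_sum]
          exact Finset.sum_congr rfl fun j hj => by
            rw [map_mul, map_pow, hz j (Finset.ne_of_mem_erase hj)]
        rw [map_mul, map_sub, ← hv, h2, ← Finset.add_sum_erase _ _ (Finset.mem_univ i),
          add_sub_cancel_right, ← mul_assoc, h1, one_mul]
      obtain ⟨r, ⟨hr, hrk⟩, -⟩ := existsUnique_pow_eq_of_map_eq f hf hk hi hw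
      refine ⟨⟨Function.update z i r, ?_, fun j => ?_⟩, ?_⟩
      · rw [← Finset.add_sum_erase _ _ (Finset.mem_univ i), Finset.sum_congr rfl fun j hj => by
            rw [Function.update_of_ne (Finset.ne_of_mem_erase hj)],
          Function.update_self, hrk, ← hb, Units.mul_inv_cancel_left, sub_add_cancel]
      · by_cases hj : j = i
        · subst hj
          simpa using hr
        · simpa [hj] using hz j hj
      · funext j
        refine Subtype.ext ?_
        simp [g, z, j.2]
  rw [Nat.card_congr (Equiv.ofBijective g hg), Nat.card_pi]
  simp [natCard_fiber_eq_natCard_ker f hf, Fintype.card_subtype_compl]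

/-- Counting solutions of a diagonal equation over a finite ring with a local surjection onto a
field, when the right-hand side does not vanish in the field. -/
theorem natCard_diagonal_eq_pow_mul {R F ι : Type*} [CommRing R] [Finite R] [Field F] [Finite F]
    [Fintype ι] (f : R →+* F) (hf : Function.Surjective f) [IsLocalHom f] {k : ℕ}
    (hk : (k : F) ≠ 0) (l : ι → R) (c : R) (hc : f c ≠ 0) :
    Nat.card {x : ι → R // ∑ j, l j * x j ^ k = c} =
      Nat.card {r : R // f r = 0} ^ (Fintype.card ι - 1) *
        Nat.card {v : ι → F // ∑ j, f (l j) * v j ^ k = f c} := by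
  classical
  let red : {x : ι → R // ∑ j, l j * x j ^ k = c} →
      {v : ι → F // ∑ j, f (l j) * v j ^ k = f c} := fun x => ⟨fun j => f (x.1 j), by
    simp [← x.2]⟩
  have := Fintype.ofFinite {v : ι → F // ∑ j, f (l j) * v j ^ k = f c}
  rw [← Nat.card_congr (Equiv.sigmaFiberEquiv red), Nat.card_sigma,
    Finset.sum_congr rfl (g := fun _ => Nat.card {r : R // f r = 0} ^ (Fintype.card ι - 1))]
  · rw [Finset.sum_const, Finset.card_univ, ← Nat.card_eq_fintype_card, smul_eq_mul, mul_comm]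
  rintro ⟨v, hv⟩ -
  obtain ⟨i, -, hi⟩ := Finset.exists_ne_zero_of_sum_ne_zero (hv.symm ▸ hc)
  have hk0 : k ≠ 0 := by rintro rfl; simp at hk
  rw [← natCard_lifts_of_nonsingular f hf hk l c v hv i (left_ne_zero_of_mul hi)
    (ne_zero_pow hk0 (right_ne_zero_of_mul hi))]
  refine Nat.card_congr ((Equiv.subtypeEquivRight fun x => ?_).trans
    (Equiv.subtypeSubtypeEquivSubtypeInter _ fun x : ι → R => ∀ j, f (x j) = v j))
  simp [red, Subtype.ext_iff, funext_iff]

/-- Variables with zero coefficient are free. -/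
theorem natCard_diagonal_eq_natCard_support {F ι : Type*} [Field F] [Finite F] [Fintype ι]
    (P : ι → Prop) [DecidablePred P] (l : ι → F) (hl : ∀ j, ¬ P j → l j = 0) (k : ℕ) (c : F) :
    Nat.card {v : ι → F // ∑ j, l j * v j ^ k = c} =
      Nat.card {v : {j // P j} → F // ∑ j : {j // P j}, l j * v j ^ k = c} *
        Nat.card F ^ Fintype.card {j // ¬ P j} := by
  let e : {v : ι → F // ∑ j, l j * v j ^ k = c} ≃
      {q : ({j // P j} → F) × ({j // ¬ P j} → F) // ∑ j : {j // P j}, l j * q.1 j ^ k = c} :=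
    (Equiv.piEquivPiSubtypeProd P fun _ => F).subtypeEquiv fun v => by
      rw [← Fintype.sum_subtype_add_sum_subtype P fun j => l j * v j ^ k,
        Finset.sum_eq_zero (s := (Finset.univ : Finset {j // ¬ P j})) fun j _ => by
          rw [hl j j.2, zero_mul], add_zero]
      rfl
  rw [Nat.card_congr e, Nat.card_congr (Equiv.prodSubtypeFstEquivSubtypeProd
    (p := fun q : {j // P j} → F => ∑ j : {j // P j}, l j * q j ^ k = c)), Nat.card_prod, Nat.card_fun,
    Nat.card_eq_fintype_card (α := {j // ¬ P j})]

theorem isLocalHom_castHom_prime_pow (p a : ℕ) [NeZero (p ^ a)] (h : p ∣ p ^ a) :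
    IsLocalHom (ZMod.castHom h (ZMod p)) := by
  refine ⟨fun r hr => ?_⟩
  obtain ⟨n, rfl⟩ := ZMod.natCast_zmod_surjective r
  rw [map_natCast, ZMod.isUnit_iff_coprime] at hr
  exact (ZMod.isUnit_iff_coprime _ _).mpr (hr.pow_right a)


/-- Theorem 4.2, equation (kkk2): for `Q = λ₁x₁^k + ⋯ + λₜxₜ^k`, `p ∤ k`, `Q` reduced at `p`,
`I_p = {i : p ∤ λᵢ}`, `t_p = |I_p|`: for `p ∤ c` and `a ≥ 1`,
`N(Q; c, p^a) = p^{(a-1)(t-1)} N(Q; c, p) = p^{at-a-t_p+1} N(Q_{I_p}; c, p)`. -/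
theorem common_exponent_case (t : ℕ) (ht : 1 ≤ t) (lam : Fin t → ℤ) (hlam : ∀ i, lam i ≠ 0)
    (k : ℕ) (hk : 1 ≤ k) (p : ℕ) (hp : p.Prime) (hpk : ¬ p ∣ k)
    (hred : ∃ i, ¬ ((p : ℤ) ∣ lam i)) (c : ℤ) (hc : ¬ (p : ℤ) ∣ c) (a : ℕ) (ha : 1 ≤ a) :
    NJ lam (fun _ => k) ∅ c (p ^ a) =
        p ^ ((a - 1) * (t - 1)) * NJ lam (fun _ => k) ∅ c p ∧
      (NJ lam (fun _ => k) ∅ c (p ^ a) : ℚ) =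
        (p : ℚ) ^ ((a * t : ℤ) - a -
            (Finset.univ.filter fun i => ¬ ((p : ℤ) ∣ lam i)).card + 1) *
          (NJOn lam (fun _ => k) (Finset.univ.filter fun i => ¬ ((p : ℤ) ∣ lam i)) ∅ c p :
            ℚ) := by
  have := Fact.mk hp
  have hdvd : p ∣ p ^ a := dvd_pow_self p (by omega)
  have : NeZero (p ^ a) := ⟨pow_ne_zero _ hp.ne_zero⟩
  let f := ZMod.castHom hdvd (ZMod p)
  have hf : Function.Surjective f := ZMod.castHom_surjective hdvd
  have : IsLocalHom f := isLocalHom_castHom_prime_pow p a hdvd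
  have hker : Nat.card {r // f r = 0} = p ^ (a - 1) := by
    have h := natCard_eq_natCard_mul_natCard_ker f hf
    rw [Nat.card_zmod, Nat.card_zmod] at h
    exact Nat.eq_of_mul_eq_mul_left hp.pos (h.symm.trans (mul_pow_sub_one (by omega) p).symm)
  have hlift : NJ lam (fun _ => k) ∅ c (p ^ a) =
      p ^ ((a - 1) * (t - 1)) * NJ lam (fun _ => k) ∅ c p := by
    have h := natCard_diagonal_eq_pow_mul f hf (k := k)
      (by rwa [Ne, ZMod.natCast_eq_zero_iff]) (fun i => (lam i : ZMod (p ^ a))) c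
      (by rwa [map_intCast, Ne, ZMod.intCast_zmod_eq_zero_iff_dvd])
    rw [hker, Fintype.card_fin, ← pow_mul] at h
    simpa [NJ] using h
  refine ⟨hlift, ?_⟩
  set S := Finset.univ.filter fun i => ¬ ((p : ℤ) ∣ lam i) with hS
  have hfree : NJ lam (fun _ => k) ∅ c p =
      NJOn lam (fun _ => k) S ∅ c p * p ^ (t - S.card) := by
    have h := natCard_diagonal_eq_natCard_support (· ∈ S) (fun i => (lam i : ZMod p))
      (fun j hj => (ZMod.intCast_zmod_eq_zero_iff_dvd _ _).mpr (by simpa [hS] using hj)) k c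
    rw [Fintype.card_subtype_compl, Fintype.card_fin, Fintype.card_coe, Nat.card_zmod] at h
    simp only [NJ, NJOn, Finset.notMem_empty, IsEmpty.forall_iff, implies_true, and_true]
    convert h
  have hcard : S.card ≤ t := by simpa using S.card_le_univ
  have hexp : (a * t : ℤ) - a - S.card + 1 = (((a - 1) * (t - 1) + (t - S.card) : ℕ) : ℤ) := by
    push_cast [ha, ht, hcard]
    ring
  rw [hlift, hfree, hexp, zpow_natCast, pow_add]
  push_cast
  ring
end

section
/- (Proposition 4.5, case e ≥ 1.) Let Q(x₁,x₂) = x₁^k + λ p^e x₂^k with p prime, p ∤ λk, and e ≥ 1. Then for every integer c with p ∤ c and every a ≥ 1: N_{{1}}(Q; c, p^a) = p^a · Σ_{χ : χ^k = 1} χ(c) and N*(Q; c, p^a) = p^{a−1}(p−1) · Σ_{χ : χ^k = 1} χ(c), as equalities of complex numbers, where the sums run over all multiplicative characters χ of 𝔽_p = ℤ/pℤ with χ^k trivial and χ(c) means χ(c mod p). Moreover, if p ∣ c then N_{{1}}(Q; c, p^a) = 0 and N*(Q; c, p^a) = 0. -/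
/-- If `f : G →* H` is surjective with kernel of order prime to `k`, then `u` has as many
`k`-th roots in `G` as `f u` has in `H`. -/
theorem card_pow_eq_of_coprime_card_ker {G H : Type*} [CommGroup G] [CommGroup H] (f : G →* H)
    (hf : Function.Surjective f) {k : ℕ} (hk : (Nat.card f.ker).Coprime k) (u : G) :
    Nat.card {x : G // x ^ k = u} = Nat.card {y : H // y ^ k = f u} := by
  refine Nat.card_congr (Equiv.ofBijective
    (fun x => ⟨f x.1, by rw [← map_pow, x.2]⟩) ⟨?_, ?_⟩)
  · rintro ⟨x, hx⟩ ⟨y, hy⟩ h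
    have hxy : f x = f y := congrArg Subtype.val h
    have hmem : x / y ∈ f.ker := by rw [MonoidHom.mem_ker, map_div, hxy, div_self']
    have hpow : (⟨x / y, hmem⟩ : f.ker) = 1 :=
      (powCoprime hk).injective (Subtype.ext (by simp [div_pow, hx, hy]))
    exact Subtype.ext (div_eq_one.mp (congrArg Subtype.val hpow))
  · rintro ⟨y, hy⟩
    obtain ⟨g, rfl⟩ := hf y
    have hmem : u / g ^ k ∈ f.ker := by rw [MonoidHom.mem_ker, map_div, map_pow, hy, div_self']
    obtain ⟨n, hn⟩ := (powCoprime hk).surjective ⟨u / g ^ k, hmem⟩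
    have hn' : (n : G) ^ k = u / g ^ k := congrArg Subtype.val hn
    refine ⟨⟨n * g, by rw [mul_pow, hn', div_mul_cancel]⟩, Subtype.ext ?_⟩
    simp [MonoidHom.mem_ker.mp n.2]

theorem ZMod.card_ker_unitsMap_prime_pow {p : ℕ} [Fact p.Prime] {a : ℕ} (ha : 1 ≤ a) :
    Nat.card (ZMod.unitsMap (dvd_pow_self p (Nat.one_le_iff_ne_zero.mp ha))).ker
      = p ^ (a - 1) := by
  have hp : p.Prime := Fact.out
  have h := (ZMod.unitsMap (dvd_pow_self p (Nat.one_le_iff_ne_zero.mp ha))).ker.card_mul_index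
  rw [Subgroup.index_ker, MonoidHom.range_eq_top.mpr (ZMod.unitsMap_surjective _),
    Subgroup.card_top, Nat.card_eq_fintype_card, Nat.card_eq_fintype_card,
    Nat.card_eq_fintype_card, ZMod.card_units_eq_totient, ZMod.card_units_eq_totient,
    Nat.totient_prime_pow hp ha, Nat.totient_prime hp] at h
  rw [Nat.card_eq_fintype_card]
  exact Nat.eq_of_mul_eq_mul_right (Nat.sub_pos_of_lt hp.one_lt) h

/-- The number of `k`-th roots of a unit `v` of `𝔽_p` is `∑_{χ^k = 1} χ v`. -/
theorem ZMod.card_units_pow_eq {p : ℕ} [Fact p.Prime] {k : ℕ} (v : (ZMod p)ˣ) :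
    (Nat.card {h : (ZMod p)ˣ // h ^ k = v} : ℂ)
      = ∑ᶠ χ ∈ {χ : MulChar (ZMod p) ℂ | χ ^ k = 1}, χ (v : ZMod p) := by
  classical
  have hp : p.Prime := Fact.out
  have hφ : (p.totient : ℂ) ≠ 0 := by exact_mod_cast (Nat.totient_pos.mpr hp.pos).ne'
  have hunits : ∀ χ : MulChar (ZMod p) ℂ,
      ∑ h : (ZMod p)ˣ, χ ((h : ZMod p) ^ k) = if χ ^ k = 1 then (p.totient : ℂ) else 0 := by
    intro χ
    split_ifs with hχ
    · have hone : ∀ h : (ZMod p)ˣ, χ ((h : ZMod p) ^ k) = 1 := fun h => by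
        rw [map_pow, ← MulChar.pow_apply_coe, hχ, MulChar.one_apply_coe]
      simp [hone, ZMod.card_units_eq_totient]
    · simp only [map_pow, ← MulChar.pow_apply_coe]
      rw [← MulChar.sum_eq_zero_of_ne_one hχ]
      refine Finset.sum_bij_ne_zero (fun h _ _ => (h : ZMod p)) (by simp)
        (fun _ _ _ _ _ _ h => Units.ext h) (fun x _ hx => ?_) (by simp)
      have hu : IsUnit x := by
        by_contra hn
        exact hx (MulChar.map_nonunit _ hn)
      exact ⟨hu.unit, Finset.mem_univ _, hx, rfl⟩
  have hdouble : (∑ h : (ZMod p)ˣ, ∑ χ : MulChar (ZMod p) ℂ,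
      χ (v : ZMod p)⁻¹ * χ ((h : ZMod p) ^ k))
      = (p.totient : ℂ) * Nat.card {h : (ZMod p)ˣ // h ^ k = v} := by
    have horth : ∀ h : (ZMod p)ˣ, ∑ χ : MulChar (ZMod p) ℂ,
        χ (v : ZMod p)⁻¹ * χ ((h : ZMod p) ^ k) = if h ^ k = v then (p.totient : ℂ) else 0 := by
      intro h
      refine (DirichletCharacter.sum_char_inv_mul_char_eq ℂ v.isUnit _).trans ?_
      simp only [← Units.val_pow_eq_pow_val, Units.val_inj, eq_comm]
    rw [Finset.sum_congr rfl fun h _ => horth h, ← Finset.sum_filter, Finset.sum_const,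
      nsmul_eq_mul, mul_comm, Nat.card_eq_fintype_card, Fintype.card_subtype]
  rw [Finset.sum_comm] at hdouble
  simp only [← Finset.mul_sum, hunits, mul_ite, mul_zero] at hdouble
  rw [← Finset.sum_filter, ← Finset.sum_mul, mul_comm] at hdouble
  rw [← mul_left_cancel₀ hφ hdouble, finsum_mem_eq_sum_of_inter_support_eq
    (t := Finset.univ.filter fun χ : MulChar (ZMod p) ℂ => χ ^ k = 1) _ (by simp)]
  refine Finset.sum_bij' (fun χ _ => χ⁻¹) (fun χ _ => χ⁻¹) ?_ ?_ ?_ ?_ ?_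
  · simp
  · simp
  · simp
  · simp
  · intro χ _
    rw [MulChar.inv_apply']

/-- The number of `k`-th roots of a unit `u` modulo `p ^ a` is `∑_{χ^k = 1} χ (u mod p)`. -/
theorem ZMod.card_units_prime_pow_pow_eq {p : ℕ} [Fact p.Prime] {a k : ℕ} (ha : 1 ≤ a)
    (hk : ¬ p ∣ k) (u : (ZMod (p ^ a))ˣ) :
    (Nat.card {x : (ZMod (p ^ a))ˣ // x ^ k = u} : ℂ)
      = ∑ᶠ χ ∈ {χ : MulChar (ZMod p) ℂ | χ ^ k = 1},
          χ (ZMod.castHom (dvd_pow_self p (Nat.one_le_iff_ne_zero.mp ha)) (ZMod p)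
            (u : ZMod (p ^ a))) := by
  have hp : p.Prime := Fact.out
  have : NeZero (p ^ a) := ⟨pow_ne_zero _ hp.ne_zero⟩
  have hcop : (Nat.card (ZMod.unitsMap
      (dvd_pow_self p (Nat.one_le_iff_ne_zero.mp ha))).ker).Coprime k := by
    rw [ZMod.card_ker_unitsMap_prime_pow ha]
    exact ((Nat.Prime.coprime_iff_not_dvd hp).mpr hk).pow_left _
  rw [card_pow_eq_of_coprime_card_ker _ (ZMod.unitsMap_surjective _) hcop,
    ZMod.card_units_pow_eq]
  rfl

/-- Pairs `(x₀, x₁)` with `x₀` a unit, `P x₁` and `x₀ ^ k + q x₁ ^ k = c`, where `p ∣ q` and `c` is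
prime to `p`, counted modulo `p ^ a`: each `x₁` contributes `∑_{χ^k = 1} χ c`. -/
theorem card_pow_add_mul_pow_eq {p : ℕ} [Fact p.Prime] {a k : ℕ} (ha : 1 ≤ a) (hk : ¬ p ∣ k)
    {q c : ℤ} (hq : (p : ℤ) ∣ q) (hc : ¬ (p : ℤ) ∣ c) (P : ZMod (p ^ a) → Prop) :
    (Nat.card {x : Fin 2 → ZMod (p ^ a) //
        x 0 ^ k + (q : ZMod (p ^ a)) * x 1 ^ k = (c : ZMod (p ^ a)) ∧ IsUnit (x 0) ∧ P (x 1)} : ℂ)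
      = Nat.card {y : ZMod (p ^ a) // P y} *
          ∑ᶠ χ ∈ {χ : MulChar (ZMod p) ℂ | χ ^ k = 1}, χ (c : ZMod p) := by
  classical
  have hp : p.Prime := Fact.out
  have : NeZero (p ^ a) := ⟨pow_ne_zero _ hp.ne_zero⟩
  have hdvd : p ∣ p ^ a := dvd_pow_self p (Nat.one_le_iff_ne_zero.mp ha)
  have hred : ∀ y : ZMod (p ^ a),
      ZMod.castHom hdvd (ZMod p) ((c : ZMod (p ^ a)) - q * y ^ k) = c := by
    intro y
    rw [map_sub, map_mul, map_intCast, map_intCast, (ZMod.intCast_zmod_eq_zero_iff_dvd q p).mpr hq]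
    simp
  have hunit : ∀ y : ZMod (p ^ a), IsUnit ((c : ZMod (p ^ a)) - q * y ^ k) := by
    intro y
    have hloc : IsUnit (ZMod.castHom hdvd (ZMod p) ((c : ZMod (p ^ a)) - q * y ^ k)) := by
      rw [hred, isUnit_iff_ne_zero, Ne, ZMod.intCast_zmod_eq_zero_iff_dvd]
      exact hc
    obtain ⟨n, hn⟩ := ZMod.natCast_zmod_surjective
      ((c : ZMod (p ^ a)) - (q : ZMod (p ^ a)) * y ^ k)
    rw [← hn] at hloc ⊢
    rw [map_natCast, ZMod.isUnit_iff_coprime] at hloc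
    rw [ZMod.isUnit_iff_coprime]
    exact hloc.pow_right a
  have e : {x : Fin 2 → ZMod (p ^ a) //
        x 0 ^ k + (q : ZMod (p ^ a)) * x 1 ^ k = (c : ZMod (p ^ a)) ∧ IsUnit (x 0) ∧ P (x 1)} ≃
      Σ y : {y : ZMod (p ^ a) // P y}, {g : (ZMod (p ^ a))ˣ // g ^ k = (hunit y.1).unit} :=
    { toFun := fun x => ⟨⟨x.1 1, x.2.2.2⟩, ⟨x.2.2.1.unit, Units.ext (by
        simpa using eq_sub_of_add_eq x.2.1)⟩⟩
      invFun := fun z => ⟨![z.2.1, z.1.1], by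
        have h : ((z.2.1 : (ZMod (p ^ a))ˣ) : ZMod (p ^ a)) ^ k = c - q * z.1.1 ^ k := by
          simpa using congrArg Units.val z.2.2
        simp [h, z.1.2]⟩
      left_inv := fun x => Subtype.ext (by
        funext i
        fin_cases i <;> simp)
      right_inv := fun z => by
        obtain ⟨⟨y, hy⟩, ⟨g, hg⟩⟩ := z
        simp }
  rw [Nat.card_congr e, Nat.card_sigma, Nat.cast_sum]
  simp only [ZMod.card_units_prime_pow_pow_eq ha hk, IsUnit.unit_spec, hred]
  simp [Nat.card_eq_fintype_card]


/-- Proposition 4.5, case `e ≥ 1`: for `Q(x₁,x₂) = x₁^k + λ p^e x₂^k` with `p ∤ λk` and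
`e ≥ 1`, for `p ∤ c` and `a ≥ 1`,
`N_{{1}}(Q; c, p^a) = p^a · ∑_{χ^k = 1} χ(c)` and
`N*(Q; c, p^a) = p^{a-1}(p-1) · ∑_{χ^k = 1} χ(c)` (as complex numbers, summing over all
multiplicative characters `χ` of `𝔽_p` with `χ^k` trivial); and if `p ∣ c` then both counts
vanish. -/
theorem two_variable_case_e_pos (p : ℕ) (hp : p.Prime) (k : ℕ) (hk : 1 ≤ k) (lam : ℤ)
    (hlamk : ¬ ((p : ℤ) ∣ lam * (k : ℤ))) (e : ℕ) (he : 1 ≤ e) (c : ℤ) (a : ℕ)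
    (ha : 1 ≤ a) :
    (¬ ((p : ℤ) ∣ c) →
        (NJ ![1, lam * (p : ℤ) ^ e] (fun _ => k) {0} c (p ^ a) : ℂ) =
            (p : ℂ) ^ a *
              ∑ᶠ χ ∈ {χ : MulChar (ZMod p) ℂ | χ ^ k = 1}, χ (c : ZMod p) ∧
          (NJ ![1, lam * (p : ℤ) ^ e] (fun _ => k) Finset.univ c (p ^ a) : ℂ) =
            (p : ℂ) ^ (a - 1) * ((p : ℂ) - 1) *
              ∑ᶠ χ ∈ {χ : MulChar (ZMod p) ℂ | χ ^ k = 1}, χ (c : ZMod p)) ∧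
      ((p : ℤ) ∣ c →
        NJ ![1, lam * (p : ℤ) ^ e] (fun _ => k) {0} c (p ^ a) = 0 ∧
          NJ ![1, lam * (p : ℤ) ^ e] (fun _ => k) Finset.univ c (p ^ a) = 0) := by
  have : Fact p.Prime := ⟨hp⟩
  have hpk : ¬ p ∣ k := fun h => hlamk (Dvd.dvd.mul_left (Int.natCast_dvd_natCast.mpr h) lam)
  have hq : (p : ℤ) ∣ lam * (p : ℤ) ^ e :=
    Dvd.dvd.mul_left (dvd_pow_self _ (Nat.one_le_iff_ne_zero.mp he)) lam
  have : NeZero (p ^ a) := ⟨pow_ne_zero _ hp.ne_zero⟩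
  constructor
  · intro hc
    constructor
    · have h := card_pow_add_mul_pow_eq ha hpk hq hc (fun _ => True)
      rw [Nat.card_congr (Equiv.subtypeUnivEquiv fun _ => trivial), Nat.card_zmod] at h
      rw [Nat.cast_pow] at h
      rw [← h]
      simp [NJ, Fin.sum_univ_two]
    · have h := card_pow_add_mul_pow_eq ha hpk hq hc IsUnit
      have hcard : Nat.card {y : ZMod (p ^ a) // IsUnit y} = (p ^ a).totient := by
        rw [← ZMod.card_units_eq_totient, ← Nat.card_eq_fintype_card]
        exact Nat.card_congr (Equiv.ofBijective (fun y => y.2.unit)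
          ⟨fun _ _ h => Subtype.ext (congrArg Units.val h),
            fun u => ⟨⟨u, u.isUnit⟩, Units.ext rfl⟩⟩)
      rw [hcard, Nat.totient_prime_pow hp ha, Nat.cast_mul,
        Nat.cast_sub hp.one_le, Nat.cast_pow, Nat.cast_one] at h
      rw [← h]
      simp [NJ, Fin.sum_univ_two, Fin.forall_fin_two]
  · intro hc
    have hdvd : p ∣ p ^ a := dvd_pow_self p (Nat.one_le_iff_ne_zero.mp ha)
    have hempty : ∀ J : Finset (Fin 2), 0 ∈ J →
        NJ ![1, lam * (p : ℤ) ^ e] (fun _ => k) J c (p ^ a) = 0 := by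
      intro J hJ
      refine @Nat.card_of_isEmpty _ ⟨?_⟩
      rintro ⟨x, hx, hJx⟩
      have hmod := congrArg (ZMod.castHom hdvd (ZMod p)) hx
      rw [Fin.sum_univ_two] at hmod
      simp only [Matrix.cons_val_zero, Matrix.cons_val_one, Int.cast_one, one_mul, map_add,
        map_mul, map_pow, map_intCast, (ZMod.intCast_zmod_eq_zero_iff_dvd _ p).mpr hq,
        (ZMod.intCast_zmod_eq_zero_iff_dvd _ p).mpr hc, zero_mul, add_zero] at hmod
      exact (((hJx 0 hJ).map (ZMod.castHom hdvd (ZMod p))).pow k).ne_zero hmod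
    exact ⟨hempty _ (by simp), hempty _ (by simp)⟩
end
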